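/- Let L > 0 and a, b, c > 0 be real numbers and let p : [0,L] → ℝ be continuous. Let M, N > 0 be constants with N ≤ (4M/L³)·σ(√M·L). Suppose α is a lower solution and β is an upper solution of problem (4.1),(1.2) satisfying 0 ≤ α(x) ≤ β(x) and 0 ≥ α''(x) ≥ β''(x) for all x ∈ [0,L], and suppose a + b·∫₀ᴸ β(t)dt ≤ M and c − b·min_{x∈[0,L]} β''(x) ≤ N. Then there exist solutions y̲ and ȳ of problem (4.1),(1.2) with α ≤ y̲ ≤ ȳ ≤ β and α'' ≥ y̲'' ≥ ȳ'' ≥ β'' on [0,L], such that every solution w of (4.1),(1.2) with α ≤ w ≤ β and α'' ≥ w'' ≥ β'' on [0,L] satisfies y̲ ≤ w ≤ ȳ and y̲'' ≥ w'' ≥ ȳ'' on [0,L]. -/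

import Mathlib

open Real

/-- The auxiliary function `σ(x) = 3x³ / (6x cosh x + 6x − 12 sinh x − x³)`. -/
noncomputable def sigmaFun (x : ℝ) : ℝ :=
  3 * x ^ 3 / (6 * x * Real.cosh x + 6 * x - 12 * Real.sinh x - x ^ 3)

/-- `w` is a (classical, C⁴ on `[0,L]`) solution of problem (4.1),(1.2):
`w'''' − (a + b∫₀ᴸ w) w'' + c∫₀ᴸ w = p` on `(0,L)` with Navier boundary
conditions `w(0) = w(L) = w''(0) = w''(L) = 0`. -/
def IsMelanSolution (L a b c : ℝ) (p w : ℝ → ℝ) : Prop :=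
  ContDiffOn ℝ 4 w (Set.Icc 0 L) ∧
  (∀ x ∈ Set.Ioo (0:ℝ) L,
    iteratedDerivWithin 4 w (Set.Icc 0 L) x
      - (a + b * ∫ t in (0:ℝ)..L, w t) * iteratedDerivWithin 2 w (Set.Icc 0 L) x
      + c * ∫ t in (0:ℝ)..L, w t = p x) ∧
  w 0 = 0 ∧ w L = 0 ∧
  iteratedDerivWithin 2 w (Set.Icc 0 L) 0 = 0 ∧
  iteratedDerivWithin 2 w (Set.Icc 0 L) L = 0

/-- `α` is a lower solution of problem (4.1),(1.2). -/
def IsMelanLowerSolution (L a b c : ℝ) (p α : ℝ → ℝ) : Prop :=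
  ContDiffOn ℝ 4 α (Set.Icc 0 L) ∧
  (∀ x ∈ Set.Ioo (0:ℝ) L,
    iteratedDerivWithin 4 α (Set.Icc 0 L) x
      - (a + b * ∫ t in (0:ℝ)..L, α t) * iteratedDerivWithin 2 α (Set.Icc 0 L) x
      + c * ∫ t in (0:ℝ)..L, α t ≤ p x) ∧
  α 0 = 0 ∧ α L = 0 ∧
  iteratedDerivWithin 2 α (Set.Icc 0 L) 0 = 0 ∧
  iteratedDerivWithin 2 α (Set.Icc 0 L) L = 0

/-- `β` is an upper solution of problem (4.1),(1.2). -/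
def IsMelanUpperSolution (L a b c : ℝ) (p β : ℝ → ℝ) : Prop :=
  ContDiffOn ℝ 4 β (Set.Icc 0 L) ∧
  (∀ x ∈ Set.Ioo (0:ℝ) L,
    p x ≤ iteratedDerivWithin 4 β (Set.Icc 0 L) x
      - (a + b * ∫ t in (0:ℝ)..L, β t) * iteratedDerivWithin 2 β (Set.Icc 0 L) x
      + c * ∫ t in (0:ℝ)..L, β t) ∧
  β 0 = 0 ∧ β L = 0 ∧
  iteratedDerivWithin 2 β (Set.Icc 0 L) 0 = 0 ∧
  iteratedDerivWithin 2 β (Set.Icc 0 L) L = 0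

section Hyperbolic

/-- A function with nonnegative derivative on `[0,∞)` and nonnegative value at `0` is nonnegative
on `[0,∞)`. -/
lemma nonneg_of_hasDerivAt_nonneg {f f' : ℝ → ℝ} (h0 : 0 ≤ f 0)
    (hd : ∀ x, HasDerivAt f (f' x) x) (hf' : ∀ x, 0 ≤ x → 0 ≤ f' x) {x : ℝ} (hx : 0 ≤ x) :
    0 ≤ f x := by
  have hmono : MonotoneOn f (Set.Ici 0) := by
    refine monotoneOn_of_deriv_nonneg (convex_Ici 0)
      (fun y _ => (hd y).continuousAt.continuousWithinAt)
      (fun y _ => (hd y).differentiableAt.differentiableWithinAt) (fun y hy => ?_)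
    rw [(hd y).deriv]
    exact hf' y (interior_subset hy)
  exact h0.trans (hmono (Set.self_mem_Ici) hx hx)

lemma sinh_le_self_mul_cosh {x : ℝ} (hx : 0 ≤ x) : sinh x ≤ x * cosh x := by
  have h := nonneg_of_hasDerivAt_nonneg (f := fun y => y * cosh y - sinh y)
    (f' := fun y => y * sinh y) (by simp)
    (fun y => (((hasDerivAt_id y).mul (Real.hasDerivAt_cosh y)).sub
      (Real.hasDerivAt_sinh y)).congr_deriv (by simp))
    (fun y hy => mul_nonneg hy (Real.sinh_nonneg_iff.2 hy)) hx
  linarith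

lemma cosh_sub_one_eq (x : ℝ) : cosh x - 1 = 2 * sinh (x / 2) ^ 2 := by
  have h := Real.cosh_two_mul (x / 2)
  rw [show 2 * (x / 2) = x by ring] at h
  have := Real.cosh_sq (x / 2)
  linarith

lemma cosh_sub_one_le {x : ℝ} (hx : 0 ≤ x) : 2 * (cosh x - 1) ≤ x * sinh x := by
  have h := Real.sinh_two_mul (x / 2)
  rw [show 2 * (x / 2) = x by ring] at h
  rw [cosh_sub_one_eq, h]
  have h1 := sinh_le_self_mul_cosh (x := x / 2) (by linarith)
  have h2 := Real.sinh_nonneg_iff.2 (show 0 ≤ x / 2 by linarith)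
  nlinarith

lemma sinh_mul_le {r x : ℝ} (hr0 : 0 ≤ r) (hr : r ≤ 1) (hx : 0 ≤ x) :
    sinh (r * x) ≤ r * sinh x := by
  have h := nonneg_of_hasDerivAt_nonneg (f := fun y => r * sinh y - sinh (r * y))
    (f' := fun y => r * (cosh y - cosh (r * y))) (by simp)
    (fun y => (((Real.hasDerivAt_sinh y).const_mul r).sub
      (((hasDerivAt_id y).const_mul r).sinh)).congr_deriv (by simp; ring))
    (fun y hy => mul_nonneg hr0 (sub_nonneg.2 (Real.cosh_le_cosh.2 (by
      rw [abs_of_nonneg hy, abs_of_nonneg (mul_nonneg hr0 hy)]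
      nlinarith)))) hx
  linarith

/-- The denominator of `sigmaFun`. -/
noncomputable def sigmaDen (x : ℝ) : ℝ := 6 * x * cosh x + 6 * x - 12 * sinh x - x ^ 3

lemma sigmaDen_mul_le {r x : ℝ} (hr0 : 0 ≤ r) (hr : r ≤ 1) (hx : 0 ≤ x) :
    sigmaDen (r * x) ≤ r ^ 5 * sigmaDen x := by
  have hlin : ∀ y : ℝ, HasDerivAt (fun y => r * y) r y := fun y => by
    simpa using (hasDerivAt_id y).const_mul r
  let D1 : ℝ → ℝ := fun y => 6 * y * sinh y - 6 * cosh y + 6 - 3 * y ^ 2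
  have hD : ∀ y, HasDerivAt sigmaDen (D1 y) y := fun y =>
    ((((((hasDerivAt_id y).const_mul 6).mul (Real.hasDerivAt_cosh y)).add
      ((hasDerivAt_id y).const_mul 6)).sub ((Real.hasDerivAt_sinh y).const_mul 12)).sub
      ((hasDerivAt_id y).pow 3)).congr_deriv (by simp [D1]; ring)
  have hD1 : ∀ y, HasDerivAt D1 (6 * y * (cosh y - 1)) y := fun y =>
    ((((((hasDerivAt_id y).const_mul 6).mul (Real.hasDerivAt_sinh y)).sub
      ((Real.hasDerivAt_cosh y).const_mul 6)).add_const 6).sub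
      (((hasDerivAt_id y).pow 2).const_mul 3)).congr_deriv (by simp; ring)
  have h2 : ∀ y, 0 ≤ y → 0 ≤ r ^ 5 * D1 y - r * D1 (r * y) := fun y hy =>
    nonneg_of_hasDerivAt_nonneg (f := fun y => r ^ 5 * D1 y - r * D1 (r * y))
      (f' := fun y => 6 * y * r ^ 3 * (r ^ 2 * (cosh y - 1) - (cosh (r * y) - 1)))
      (by simp [D1])
      (fun y => (((hD1 y).const_mul _).sub
        (((hD1 (r * y)).comp y (hlin y)).const_mul r)).congr_deriv (by ring))
      (fun y hy => by
        refine mul_nonneg (by positivity) ?_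
        rw [cosh_sub_one_eq, cosh_sub_one_eq, mul_div_assoc]
        have h1 := sinh_mul_le hr0 hr (show 0 ≤ y / 2 by linarith)
        have h2 := Real.sinh_nonneg_iff.2 (show 0 ≤ r * (y / 2) by positivity)
        nlinarith [mul_self_le_mul_self h2 h1]) hy
  have h := nonneg_of_hasDerivAt_nonneg (f := fun y => r ^ 5 * sigmaDen y - sigmaDen (r * y))
      (f' := fun y => r ^ 5 * D1 y - r * D1 (r * y)) (by simp [sigmaDen])
      (fun y => (((hD y).const_mul _).sub ((hD (r * y)).comp y (hlin y))).congr_deriv (by ring))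
      h2 hx
  linarith

end Hyperbolic

section Jets

/-- `d k`, `k ≤ 4`, are the successive derivatives on `[0,L]` of a `C⁴` function satisfying the
Navier boundary conditions. -/
structure IsNavierJet (L : ℝ) (d : ℕ → ℝ → ℝ) : Prop where
  cont : ∀ k ≤ 4, ContinuousOn (d k) (Set.Icc 0 L)
  deriv : ∀ k < 4, ∀ x ∈ Set.Ioo 0 L, HasDerivAt (d k) (d (k + 1) x) x
  left : d 0 0 = 0
  right : d 0 L = 0
  left2 : d 2 0 = 0
  right2 : d 2 L = 0

lemma IsNavierJet.sub {L : ℝ} {d e : ℕ → ℝ → ℝ} (hd : IsNavierJet L d) (he : IsNavierJet L e) :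
    IsNavierJet L (fun k x => d k x - e k x) where
  cont k hk := (hd.cont k hk).sub (he.cont k hk)
  deriv k hk x hx := (hd.deriv k hk x hx).sub (he.deriv k hk x hx)
  left := by simp [hd.left, he.left]
  right := by simp [hd.right, he.right]
  left2 := by simp [hd.left2, he.left2]
  right2 := by simp [hd.right2, he.right2]

lemma ContDiffOn.isNavierJet {L : ℝ} (hL : 0 < L) {w : ℝ → ℝ}
    (hw : ContDiffOn ℝ 4 w (Set.Icc 0 L)) (h0 : w 0 = 0) (h1 : w L = 0)
    (h2 : iteratedDerivWithin 2 w (Set.Icc 0 L) 0 = 0)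
    (h3 : iteratedDerivWithin 2 w (Set.Icc 0 L) L = 0) :
    IsNavierJet L (fun k => iteratedDerivWithin k w (Set.Icc 0 L)) where
  cont k hk := hw.continuousOn_iteratedDerivWithin (by exact_mod_cast hk) (uniqueDiffOn_Icc hL)
  deriv k hk x hx := by
    have hd := hw.differentiableOn_iteratedDerivWithin (m := k) (by exact_mod_cast hk)
      (uniqueDiffOn_Icc hL) x (Set.Ioo_subset_Icc_self hx)
    rw [iteratedDerivWithin_succ]
    exact hd.hasDerivWithinAt.hasDerivAt (Icc_mem_nhds hx.1 hx.2)
  left := by simpa using h0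
  right := by simpa using h1
  left2 := h2
  right2 := h3

lemma IsNavierJet.nonneg {L : ℝ} (hL : 0 < L) {d : ℕ → ℝ → ℝ} (hd : IsNavierJet L d)
    (h2 : ∀ x ∈ Set.Icc 0 L, d 2 x ≤ 0) {x : ℝ} (hx : x ∈ Set.Icc 0 L) : 0 ≤ d 0 x := by
  have hc : ConcaveOn ℝ (Set.Icc 0 L) (d 0) := by
    refine concaveOn_of_hasDerivWithinAt2_nonpos (convex_Icc 0 L) (hd.cont 0 (by norm_num))
      (f' := d 1) (f'' := d 2) ?_ ?_ ?_ <;> rw [interior_Icc] <;> intro y hy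
    · exact (hd.deriv 0 (by norm_num) y hy).hasDerivWithinAt
    · exact (hd.deriv 1 (by norm_num) y hy).hasDerivWithinAt
    · exact h2 y (Set.Ioo_subset_Icc_self hy)
  have := hc.min_le_of_mem_Icc (Set.left_mem_Icc.2 hL.le) (Set.right_mem_Icc.2 hL.le) hx
  simpa [hd.left, hd.right] using this

end Jets

section Kernel

/-- The jet of the solution `ψ` of `D⁴ψ - m² D²ψ = 1` with Navier boundary conditions. -/
noncomputable def unitLoadJet (L m : ℝ) : ℕ → ℝ → ℝ
  | 0 => fun s => (s * (L - s) / 2 -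
      (1 - cosh (m * s) + sinh (m * L) / (cosh (m * L) + 1) * sinh (m * s)) / m ^ 2) / m ^ 2
  | 1 => fun s => ((L - 2 * s) / 2 -
      (-sinh (m * s) + sinh (m * L) / (cosh (m * L) + 1) * cosh (m * s)) / m) / m ^ 2
  | 2 => fun s =>
      (-1 + cosh (m * s) - sinh (m * L) / (cosh (m * L) + 1) * sinh (m * s)) / m ^ 2
  | 3 => fun s => (sinh (m * s) - sinh (m * L) / (cosh (m * L) + 1) * cosh (m * s)) / m
  | _ => fun s => cosh (m * s) - sinh (m * L) / (cosh (m * L) + 1) * sinh (m * s)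

lemma hasDerivAt_sinh_mul (m x : ℝ) :
    HasDerivAt (fun s => sinh (m * s)) (m * cosh (m * x)) x :=
  ((hasDerivAt_id x).const_mul m).sinh.congr_deriv (by simp; ring)

lemma hasDerivAt_cosh_mul (m x : ℝ) :
    HasDerivAt (fun s => cosh (m * s)) (m * sinh (m * x)) x :=
  ((hasDerivAt_id x).const_mul m).cosh.congr_deriv (by simp; ring)

lemma sinh_div_cosh_add_one_mul (z : ℝ) : sinh z / (cosh z + 1) * sinh z = cosh z - 1 := by
  have h1 : cosh z + 1 ≠ 0 := by have := Real.cosh_pos z; positivity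
  have h2 := Real.cosh_sq z
  field_simp
  linarith

lemma isNavierJet_unitLoadJet {L m : ℝ} (hm : 0 < m) : IsNavierJet L (unitLoadJet L m) := by
  have hd : ∀ k < 4, ∀ x, HasDerivAt (unitLoadJet L m k) (unitLoadJet L m (k + 1) x) x := by
    intro k hk x
    have hS := hasDerivAt_sinh_mul m x
    have hC := hasDerivAt_cosh_mul m x
    have hi := hasDerivAt_id x
    have hm0 := hm.ne'
    generalize hT : sinh (m * L) / (cosh (m * L) + 1) = T
    interval_cases k <;> simp only [unitLoadJet, hT]
    · exact ((((hi.mul (hi.const_sub L)).div_const 2).sub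
        (((hC.const_sub 1).add (hS.const_mul T)).div_const (m ^ 2))).div_const
          (m ^ 2)).congr_deriv (by simp; field_simp; ring)
    · exact (((((hi.const_mul 2).const_sub L).div_const 2).sub
        ((hS.neg.add (hC.const_mul T)).div_const m)).div_const (m ^ 2)).congr_deriv
          (by simp; field_simp; ring)
    · exact (((hC.const_add (-1)).sub (hS.const_mul T)).div_const (m ^ 2)).congr_deriv
          (by field_simp)
    · exact ((hS.sub (hC.const_mul T)).div_const m).congr_deriv (by field_simp)
  have hT := sinh_div_cosh_add_one_mul (m * L)
  refine ⟨fun k hk => ?_, fun k hk x _ => hd k hk x, ?_, ?_, ?_, ?_⟩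
  · rcases hk.lt_or_eq with hk | rfl
    · exact fun x _ => (hd k hk x).continuousAt.continuousWithinAt
    · simp only [unitLoadJet]; fun_prop
  · simp [unitLoadJet]
  · simp [unitLoadJet, hT]
  · simp [unitLoadJet]
  · simp [unitLoadJet, hT]; left; ring

lemma unitLoadJet_equation {L m : ℝ} (hm : 0 < m) (s : ℝ) :
    unitLoadJet L m 4 s - m ^ 2 * unitLoadJet L m 2 s = 1 := by
  simp only [unitLoadJet]; field_simp; ring

/-- Duality with the unit load: the mean of `d` is the `ψ`-weighted mean of its load. -/
lemma IsNavierJet.integral_eq {L m : ℝ} (hL : 0 < L) (hm : 0 < m) {d : ℕ → ℝ → ℝ}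
    (hd : IsNavierJet L d) :
    ∫ s in (0:ℝ)..L, d 0 s =
      ∫ s in (0:ℝ)..L, unitLoadJet L m 0 s * (d 4 s - m ^ 2 * d 2 s) := by
  have hψ := isNavierJet_unitLoadJet (L := L) hm
  set ψ := unitLoadJet L m
  have c : ∀ {k}, k ≤ 4 → ContinuousOn (d k) (Set.Icc 0 L) := fun h => hd.cont _ h
  have e : ∀ {k}, k ≤ 4 → ContinuousOn (ψ k) (Set.Icc 0 L) := fun h => hψ.cont _ h
  have c0 := c (k := 0) (by norm_num)
  have c1 := c (k := 1) (by norm_num)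
  have c2 := c (k := 2) (by norm_num)
  have c3 := c (k := 3) (by norm_num)
  have c4 := c (k := 4) (by norm_num)
  have e0 := e (k := 0) (by norm_num)
  have e1 := e (k := 1) (by norm_num)
  have e2 := e (k := 2) (by norm_num)
  have e3 := e (k := 3) (by norm_num)
  have hi : ∀ {f : ℝ → ℝ}, ContinuousOn f (Set.Icc 0 L) →
      IntervalIntegrable f MeasureTheory.volume 0 L := fun h =>
    h.intervalIntegrable_of_Icc hL.le
  have key := intervalIntegral.integral_eq_sub_of_hasDerivAt_of_le hL.le
    (f := fun s => ψ 0 s * d 3 s - ψ 1 s * d 2 s + ψ 2 s * d 1 s - ψ 3 s * d 0 s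
      - m ^ 2 * (ψ 0 s * d 1 s - ψ 1 s * d 0 s))
    (f' := fun s => ψ 0 s * (d 4 s - m ^ 2 * d 2 s) - d 0 s)
    (by fun_prop) (fun s hs => by
      have D : ∀ {k}, k < 4 → HasDerivAt (d k) (d (k + 1) s) s := fun h => hd.deriv _ h s hs
      have E : ∀ {k}, k < 4 → HasDerivAt (ψ k) (ψ (k + 1) s) s := fun h => hψ.deriv _ h s hs
      have h1 := unitLoadJet_equation (L := L) hm s
      refine (((((E (k := 0) (by norm_num)).mul (D (k := 3) (by norm_num))).sub
        ((E (k := 1) (by norm_num)).mul (D (k := 2) (by norm_num)))).add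
        ((E (k := 2) (by norm_num)).mul (D (k := 1) (by norm_num)))).sub
        ((E (k := 3) (by norm_num)).mul (D (k := 0) (by norm_num))) |>.sub
        ((((E (k := 0) (by norm_num)).mul (D (k := 1) (by norm_num))).sub
        ((E (k := 1) (by norm_num)).mul (D (k := 0) (by norm_num)))).const_mul (m ^ 2))).congr_deriv
        ?_
      simp only [Nat.reduceAdd]
      linear_combination (-d 0 s) * h1)
    (hi (by fun_prop))
  simp only [hψ.left, hψ.right, hψ.left2, hψ.right2, hd.left, hd.right, hd.left2, hd.right2] at key
  rw [intervalIntegral.integral_sub (hi (by fun_prop)) (hi c0)] at key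
  linarith

/-- Green's representation of `-D²d` in terms of the load of `d`. -/
lemma IsNavierJet.green {L m : ℝ} {d : ℕ → ℝ → ℝ}
    (hd : IsNavierJet L d) {x : ℝ} (hx : x ∈ Set.Ioo 0 L) :
    -(m * sinh (m * L) * d 2 x) =
      sinh (m * (L - x)) * (∫ s in (0:ℝ)..x, sinh (m * s) * (d 4 s - m ^ 2 * d 2 s)) +
      sinh (m * x) * (∫ s in x..L, sinh (m * (L - s)) * (d 4 s - m ^ 2 * d 2 s)) := by
  have c2 := hd.cont 2 (by norm_num)
  have c3 := hd.cont 3 (by norm_num)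
  have c4 := hd.cont 4 (by norm_num)
  have s1 : Set.Icc 0 x ⊆ Set.Icc 0 L := Set.Icc_subset_Icc_right hx.2.le
  have s2 : Set.Icc x L ⊆ Set.Icc 0 L := Set.Icc_subset_Icc_left hx.1.le
  have k1 := intervalIntegral.integral_eq_sub_of_hasDerivAt_of_le hx.1.le
    (f := fun s => sinh (m * s) * d 3 s - m * (cosh (m * s) * d 2 s))
    (f' := fun s => sinh (m * s) * (d 4 s - m ^ 2 * d 2 s))
    (ContinuousOn.mono (by fun_prop) s1)
    (fun s hs => by
      have hs' : s ∈ Set.Ioo 0 L := ⟨hs.1, hs.2.trans hx.2⟩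
      exact (((hasDerivAt_sinh_mul m s).mul (hd.deriv 3 (by norm_num) s hs')).sub
        (((hasDerivAt_cosh_mul m s).mul (hd.deriv 2 (by norm_num) s hs')).const_mul m)).congr_deriv
        (by simp only [Nat.reduceAdd]; ring))
    (ContinuousOn.intervalIntegrable_of_Icc hx.1.le (ContinuousOn.mono (by fun_prop) s1))
  have k2 := intervalIntegral.integral_eq_sub_of_hasDerivAt_of_le hx.2.le
    (f := fun s => sinh (m * (L - s)) * d 3 s + m * (cosh (m * (L - s)) * d 2 s))
    (f' := fun s => sinh (m * (L - s)) * (d 4 s - m ^ 2 * d 2 s))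
    (ContinuousOn.mono (by fun_prop) s2)
    (fun s hs => by
      have hs' : s ∈ Set.Ioo 0 L := ⟨hx.1.trans hs.1, hs.2⟩
      have hl : HasDerivAt (fun s => m * (L - s)) (-m) s := by
        simpa using ((hasDerivAt_id s).const_sub L).const_mul m
      exact ((hl.sinh.mul (hd.deriv 3 (by norm_num) s hs')).add
        ((hl.cosh.mul (hd.deriv 2 (by norm_num) s hs')).const_mul m)).congr_deriv
        (by simp only [Nat.reduceAdd]; ring))
    (ContinuousOn.intervalIntegrable_of_Icc hx.2.le (ContinuousOn.mono (by fun_prop) s2))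
  rw [k1, k2]
  have ha : sinh (m * L) = sinh (m * (L - x)) * cosh (m * x) +
      cosh (m * (L - x)) * sinh (m * x) := by
    rw [← Real.sinh_add]; ring_nf
  simp only [hd.left2, hd.right2, sub_self, mul_zero, Real.sinh_zero, zero_mul, ha]
  ring

end Kernel

section Comparison

/-- Maximum principle for `D⁴d - m² D²d` with Navier boundary conditions. -/
lemma IsNavierJet.second_nonpos {L m : ℝ} (hL : 0 < L) (hm : 0 < m) {d : ℕ → ℝ → ℝ}
    (hd : IsNavierJet L d) (h : ∀ x ∈ Set.Ioo 0 L, 0 ≤ d 4 x - m ^ 2 * d 2 x) :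
    ∀ x ∈ Set.Icc 0 L, d 2 x ≤ 0 := by
  intro x hx
  rcases hx.1.eq_or_lt with rfl | hx0
  · exact hd.left2.le
  rcases hx.2.eq_or_lt with rfl | hxL
  · exact hd.right2.le
  have hg := hd.green (m := m) ⟨hx0, hxL⟩
  have hS : ∀ {t}, 0 ≤ t → 0 ≤ sinh (m * t) := fun ht =>
    Real.sinh_nonneg_iff.2 (mul_nonneg hm.le ht)
  have hae : ∀ {u v : ℝ} {f : ℝ → ℝ}, u ≤ v → (∀ s ∈ Set.Ioo u v, 0 ≤ f s) →
      0 ≤ ∫ s in u..v, f s := fun {u v f} huv hf => by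
    rw [intervalIntegral.integral_of_le huv, MeasureTheory.integral_Ioc_eq_integral_Ioo]
    exact MeasureTheory.setIntegral_nonneg measurableSet_Ioo hf
  have h1 := hae (f := fun s => sinh (m * s) * (d 4 s - m ^ 2 * d 2 s)) hx0.le
    (fun s hs => mul_nonneg (hS hs.1.le) (h s ⟨hs.1, hs.2.trans hxL⟩))
  have h2 := hae (f := fun s => sinh (m * (L - s)) * (d 4 s - m ^ 2 * d 2 s)) hxL.le
    (fun s hs => mul_nonneg (hS (sub_nonneg.2 hs.2.le)) (h s ⟨hx0.trans hs.1, hs.2⟩))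
  have h3 : 0 < m * sinh (m * L) := mul_pos hm (Real.sinh_pos_iff.2 (mul_pos hm hL))
  have h4 := mul_nonneg (hS (sub_nonneg.2 hxL.le)) h1
  have h5 := mul_nonneg (hS hx0.le) h2
  by_contra! hcon
  have := mul_pos h3 hcon
  linarith

lemma unitLoadJet_nonneg {L m : ℝ} (hL : 0 < L) (hm : 0 < m) {s : ℝ} (hs : s ∈ Set.Icc 0 L) :
    0 ≤ unitLoadJet L m 0 s :=
  have hψ := isNavierJet_unitLoadJet (L := L) hm
  hψ.nonneg hL (hψ.second_nonpos hL hm fun x _ => by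
    rw [unitLoadJet_equation hm]; exact zero_le_one) hs

lemma unitLoadJet_symm (L m s : ℝ) :
    unitLoadJet L m 0 (L - s) = unitLoadJet L m 0 s := by
  have hT := sinh_div_cosh_add_one_mul (m * L)
  have hTC : sinh (m * L) / (cosh (m * L) + 1) * (cosh (m * L) + 1) = sinh (m * L) :=
    div_mul_cancel₀ _ (by have := Real.cosh_pos (m * L); positivity)
  simp only [unitLoadJet]
  rw [mul_sub m L s, Real.cosh_sub, Real.sinh_sub]
  generalize sinh (m * L) / (cosh (m * L) + 1) = T at *
  congr 1
  congr 1
  · ring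
  · congr 1
    linear_combination cosh (m * s) * hT - sinh (m * s) * hTC

/-- The slope of the unit load deflection at the endpoint. -/
noncomputable def unitLoadSlope (L m : ℝ) : ℝ :=
  (L / 2 - sinh (m * L) / (cosh (m * L) + 1) / m) / m ^ 2

lemma unitLoadJet_le {L m : ℝ} (hm : 0 < m) {s : ℝ} (hs : s ∈ Set.Icc 0 L) :
    unitLoadJet L m 0 s ≤ unitLoadSlope L m * (sinh (m * s) / m) := by
  have ht : 0 ≤ m * s := mul_nonneg hm.le hs.1
  have h1 := cosh_sub_one_le ht
  have h2 := Real.self_le_sinh_iff.2 ht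
  have h3 : m * s ≤ m * L := mul_le_mul_of_nonneg_left hs.2 hm.le
  have h4 : 0 ≤ (m * L - m * s) * (sinh (m * s) - m * s) :=
    mul_nonneg (sub_nonneg.2 h3) (sub_nonneg.2 h2)
  have key : unitLoadSlope L m * (sinh (m * s) / m) - unitLoadJet L m 0 s
      = (m * L * (sinh (m * s) - m * s) - (2 * (cosh (m * s) - 1) - (m * s) ^ 2))
        / (2 * m ^ 4) := by
    simp only [unitLoadJet, unitLoadSlope]
    field_simp
    ring
  have : 0 ≤ (m * L * (sinh (m * s) - m * s) - (2 * (cosh (m * s) - 1) - (m * s) ^ 2))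
        / (2 * m ^ 4) := div_nonneg (by nlinarith) (by positivity)
  linarith

lemma integral_unitLoadJet {L m : ℝ} (hm : 0 < m) :
    ∫ s in (0:ℝ)..L, unitLoadJet L m 0 s =
      (L ^ 3 / 12 - (L - 2 * (sinh (m * L) / (cosh (m * L) + 1)) / m) / m ^ 2) / m ^ 2 := by
  have hT := sinh_div_cosh_add_one_mul (m * L)
  have hTC : sinh (m * L) / (cosh (m * L) + 1) * (cosh (m * L) + 1) = sinh (m * L) :=
    div_mul_cancel₀ _ (by have := Real.cosh_pos (m * L); positivity)
  simp only [unitLoadJet]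
  generalize sinh (m * L) / (cosh (m * L) + 1) = T at *
  rw [intervalIntegral.integral_eq_sub_of_hasDerivAt
    (f := fun s => (L * s ^ 2 / 4 - s ^ 3 / 6 -
      (s - sinh (m * s) / m + T * cosh (m * s) / m) / m ^ 2) / m ^ 2)]
  · have hm0 := hm.ne'
    simp
    generalize sinh (m * L) = S at *
    generalize cosh (m * L) = C at *
    field_simp
    linear_combination (-288) * hTC
  · intro s _
    have hS := hasDerivAt_sinh_mul m s
    have hC := hasDerivAt_cosh_mul m s
    have hi := hasDerivAt_id s
    exact ((((((hi.pow 2).const_mul L).div_const 4).sub ((hi.pow 3).div_const 6)).sub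
      (((hi.sub (hS.div_const m)).add ((hC.const_mul T).div_const m)).div_const
        (m ^ 2))).div_const (m ^ 2)).congr_deriv (by simp; field_simp; ring)
  · exact Continuous.intervalIntegrable (by fun_prop) _ _

/-- The threshold condition in terms of the unit load deflection. -/
lemma threshold_le {L m N : ℝ} (hm : 0 < m) (hN : N * sigmaDen (m * L) ≤ 12 * m ^ 5) :
    N * ((cosh (m * L) - 1) * unitLoadSlope L m / m ^ 2) ≤
      1 + N * ∫ s in (0:ℝ)..L, unitLoadJet L m 0 s := by
  have hTC : sinh (m * L) / (cosh (m * L) + 1) * (cosh (m * L) + 1) = sinh (m * L) :=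
    div_mul_cancel₀ _ (by have := Real.cosh_pos (m * L); positivity)
  have key : (cosh (m * L) - 1) * unitLoadSlope L m / m ^ 2 -
      ∫ s in (0:ℝ)..L, unitLoadJet L m 0 s = sigmaDen (m * L) / (12 * m ^ 5) := by
    rw [integral_unitLoadJet hm]
    simp only [unitLoadSlope, sigmaDen]
    generalize sinh (m * L) / (cosh (m * L) + 1) = T at *
    field_simp
    linear_combination (-24) * hTC
  have h2 : N * (sigmaDen (m * L) / (12 * m ^ 5)) ≤ 1 := by
    rw [← mul_div_assoc, div_le_one (by positivity)]
    exact hN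
  rw [← key] at h2
  linarith

lemma sinh_sub_sinh_sub_le {p q : ℝ} (hp : 0 ≤ p) (hq : 0 ≤ q) :
    sinh (p + q) - sinh p - sinh q ≤ (cosh (p + q) - 1) * sinh p := by
  have h := Real.sinh_sub (p + q) p
  rw [add_sub_cancel_left] at h
  have h1 := Real.sinh_nonneg_iff.2 (add_nonneg hp hq)
  have h2 := Real.one_le_cosh p
  nlinarith [mul_nonneg h1 (sub_nonneg.2 h2)]

lemma sinh_add_sinh_le {p q : ℝ} (hp : 0 ≤ p) (hq : 0 ≤ q) :
    sinh p + sinh q ≤ sinh (p + q) := by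
  rw [Real.sinh_add]
  nlinarith [Real.one_le_cosh p, Real.one_le_cosh q, Real.sinh_nonneg_iff.2 hp,
    Real.sinh_nonneg_iff.2 hq]

lemma integral_sinh_mul {m : ℝ} (hm : 0 < m) (x : ℝ) :
    ∫ s in (0:ℝ)..x, sinh (m * s) = (cosh (m * x) - 1) / m := by
  rw [intervalIntegral.integral_eq_sub_of_hasDerivAt (f := fun s => cosh (m * s) / m)]
  · simp; ring
  · exact fun s _ => ((hasDerivAt_cosh_mul m s).div_const m).congr_deriv (by field_simp)
  · exact Continuous.intervalIntegrable (by fun_prop) _ _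

/-- Maximum principle for the nonlocal operator `D⁴d - m² D²d + N ∫ d` with Navier boundary
conditions, for `N` below the threshold. -/
lemma IsNavierJet.second_nonpos_of_nonlocal {L m N : ℝ} (hL : 0 < L) (hm : 0 < m) (hN0 : 0 ≤ N)
    (hN : N * sigmaDen (m * L) ≤ 12 * m ^ 5) {d : ℕ → ℝ → ℝ} (hd : IsNavierJet L d)
    (h : ∀ x ∈ Set.Ioo 0 L,
      0 ≤ d 4 x - m ^ 2 * d 2 x + N * ∫ s in (0:ℝ)..L, d 0 s) :
    ∀ x ∈ Set.Icc 0 L, d 2 x ≤ 0 := by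
  intro x hx
  rcases hx.1.eq_or_lt with rfl | hx0
  · exact hd.left2.le
  rcases hx.2.eq_or_lt with rfl | hxL
  · exact hd.right2.le
  have hg := hd.green (m := m) ⟨hx0, hxL⟩
  have hI := hd.integral_eq hL hm
  set κ := N * ∫ s in (0:ℝ)..L, d 0 s with hκ
  have c2 := hd.cont 2 (by norm_num)
  have c4 := hd.cont 4 (by norm_num)
  have cψ := (isNavierJet_unitLoadJet (L := L) hm).cont 0 (by norm_num)
  set ψ := unitLoadJet L m 0 with hψ
  set f : ℝ → ℝ := fun s => d 4 s - m ^ 2 * d 2 s + κ with hf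
  have cf : ContinuousOn f (Set.Icc 0 L) := by fun_prop
  have s1 : Set.Icc 0 x ⊆ Set.Icc 0 L := Set.Icc_subset_Icc_right hx.2
  have s2 : Set.Icc x L ⊆ Set.Icc 0 L := Set.Icc_subset_Icc_left hx.1
  have i0 : ∀ {q : ℝ → ℝ}, ContinuousOn q (Set.Icc 0 L) →
      IntervalIntegrable q MeasureTheory.volume 0 L := fun hq =>
    hq.intervalIntegrable_of_Icc hL.le
  have i1 : ∀ {q : ℝ → ℝ}, ContinuousOn q (Set.Icc 0 L) →
      IntervalIntegrable q MeasureTheory.volume 0 x := fun hq =>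
    (hq.mono s1).intervalIntegrable_of_Icc hx.1
  have i2 : ∀ {q : ℝ → ℝ}, ContinuousOn q (Set.Icc 0 L) →
      IntervalIntegrable q MeasureTheory.volume x L := fun hq =>
    (hq.mono s2).intervalIntegrable_of_Icc hx.2
  have hgf : ∀ s, d 4 s - m ^ 2 * d 2 s = f s - κ := fun s => by simp [hf]
  have e1 : (∫ s in (0:ℝ)..x, sinh (m * s) * (d 4 s - m ^ 2 * d 2 s)) =
      (∫ s in (0:ℝ)..x, sinh (m * s) * f s) - κ * ((cosh (m * x) - 1) / m) := by
    rw [← integral_sinh_mul hm, ← intervalIntegral.integral_const_mul,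
      ← intervalIntegral.integral_sub (i1 (by fun_prop)) (i1 (by fun_prop))]
    simp only [hgf]
    congr 1; ext s; ring
  have e2 : (∫ s in x..L, sinh (m * (L - s)) * (d 4 s - m ^ 2 * d 2 s)) =
      (∫ s in x..L, sinh (m * (L - s)) * f s) - κ * ((cosh (m * (L - x)) - 1) / m) := by
    have hr : ∫ s in x..L, sinh (m * (L - s)) = (cosh (m * (L - x)) - 1) / m := by
      rw [← integral_sinh_mul hm,
        intervalIntegral.integral_comp_sub_left (fun s => sinh (m * s)) L]
      simp
    rw [← hr, ← intervalIntegral.integral_const_mul,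
      ← intervalIntegral.integral_sub (i2 (by fun_prop)) (i2 (by fun_prop))]
    simp only [hgf]
    congr 1; ext s; ring
  have e3 : (∫ s in (0:ℝ)..L, ψ s * (d 4 s - m ^ 2 * d 2 s)) =
      (∫ s in (0:ℝ)..x, ψ s * f s) + (∫ s in x..L, ψ s * f s) -
        κ * ∫ s in (0:ℝ)..L, ψ s := by
    rw [intervalIntegral.integral_add_adjacent_intervals (i1 (by fun_prop)) (i2 (by fun_prop)),
      ← intervalIntegral.integral_const_mul,
      ← intervalIntegral.integral_sub (i0 (by fun_prop)) (i0 (by fun_prop))]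
    simp only [hgf]
    congr 1; ext s; ring
  have hthr := threshold_le (L := L) hm hN
  rw [e1, e2] at hg
  rw [e3] at hI
  have hψ0 : 0 ≤ ∫ s in (0:ℝ)..L, ψ s :=
    intervalIntegral.integral_nonneg hL.le fun s hs => unitLoadJet_nonneg hL hm hs
  set Ψ := ∫ s in (0:ℝ)..L, ψ s
  set R := (sinh (m * L) - sinh (m * x) - sinh (m * (L - x))) / m with hR
  have hsum : m * x + m * (L - x) = m * L := by ring
  have px : 0 ≤ m * x := mul_nonneg hm.le hx.1
  have py : 0 ≤ m * (L - x) := mul_nonneg hm.le (sub_nonneg.2 hx.2)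
  have hR0 : 0 ≤ R := by
    have := sinh_add_sinh_le px py
    rw [hsum] at this
    exact div_nonneg (by linarith) hm.le
  have hR1 : R ≤ (cosh (m * L) - 1) / m * sinh (m * x) := by
    have := sinh_sub_sinh_sub_le px py
    rw [hsum] at this
    rw [hR, div_mul_eq_mul_div]
    gcongr
  have hR2 : R ≤ (cosh (m * L) - 1) / m * sinh (m * (L - x)) := by
    have := sinh_sub_sinh_sub_le py px
    rw [add_comm, hsum] at this
    rw [hR, div_mul_eq_mul_div]
    gcongr
    linarith
  have hCpos : 0 < 1 + N * Ψ := by positivity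
  have hCh := sub_nonneg.2 (Real.one_le_cosh (m * L))
  have b : ∀ {A s t : ℝ}, 0 ≤ A → 0 ≤ t → 0 ≤ ψ s → R ≤ (cosh (m * L) - 1) / m * A →
      ψ s ≤ unitLoadSlope L m * (t / m) → N * R * ψ s ≤ (1 + N * Ψ) * A * t := by
    intro A s t hA ht hs hRA hst
    calc N * R * ψ s ≤ N * ((cosh (m * L) - 1) / m * A) * (unitLoadSlope L m * (t / m)) := by
          gcongr
      _ = N * ((cosh (m * L) - 1) * unitLoadSlope L m / m ^ 2) * (A * t) := by
          field_simp
      _ ≤ (1 + N * Ψ) * (A * t) := mul_le_mul_of_nonneg_right hthr (mul_nonneg hA ht)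
      _ = _ := by ring
  have k1 : N * R * (∫ s in (0:ℝ)..x, ψ s * f s) ≤
      (1 + N * Ψ) * sinh (m * (L - x)) * ∫ s in (0:ℝ)..x, sinh (m * s) * f s := by
    rw [← intervalIntegral.integral_const_mul, ← intervalIntegral.integral_const_mul]
    refine intervalIntegral.integral_mono_on_of_le_Ioo hx.1 (i1 (by fun_prop))
      (i1 (by fun_prop)) fun s hs => ?_
    have hs' : s ∈ Set.Ioo 0 L := ⟨hs.1, hs.2.trans hxL⟩
    have hsc := Set.Ioo_subset_Icc_self hs'
    rw [← mul_assoc, ← mul_assoc]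
    exact mul_le_mul_of_nonneg_right (b (Real.sinh_nonneg_iff.2 py)
      (Real.sinh_nonneg_iff.2 (mul_nonneg hm.le hs.1.le)) (unitLoadJet_nonneg hL hm hsc) hR2
      (unitLoadJet_le hm hsc)) (h s hs')
  have k2 : N * R * (∫ s in x..L, ψ s * f s) ≤
      (1 + N * Ψ) * sinh (m * x) * ∫ s in x..L, sinh (m * (L - s)) * f s := by
    rw [← intervalIntegral.integral_const_mul, ← intervalIntegral.integral_const_mul]
    refine intervalIntegral.integral_mono_on_of_le_Ioo hx.2 (i2 (by fun_prop))
      (i2 (by fun_prop)) fun s hs => ?_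
    have hs' : s ∈ Set.Ioo 0 L := ⟨hx0.trans hs.1, hs.2⟩
    have hsc := Set.Ioo_subset_Icc_self hs'
    have hsr : L - s ∈ Set.Icc 0 L := ⟨by linarith [hs.2], by linarith [hsc.1]⟩
    rw [← mul_assoc, ← mul_assoc]
    refine mul_le_mul_of_nonneg_right (b (Real.sinh_nonneg_iff.2 px)
      (Real.sinh_nonneg_iff.2 (mul_nonneg hm.le hsr.1)) (unitLoadJet_nonneg hL hm hsc) hR1
      ?_) (h s hs')
    rw [hψ, ← unitLoadJet_symm]
    exact unitLoadJet_le hm hsr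
  have hRe : sinh (m * (L - x)) * ((cosh (m * x) - 1) / m) +
      sinh (m * x) * ((cosh (m * (L - x)) - 1) / m) = R := by
    rw [hR, ← hsum, Real.sinh_add]
    ring
  have hκ' : κ * (1 + N * Ψ) =
      N * ((∫ s in (0:ℝ)..x, ψ s * f s) + ∫ s in x..L, ψ s * f s) := by
    linear_combination hκ + N * hI
  have hfin : 0 ≤ (1 + N * Ψ) * -(m * sinh (m * L) * d 2 x) := by
    rw [hg]
    linear_combination k1 + k2 + (1 + N * Ψ) * κ * hRe + R * hκ'
  have h3 : 0 < m * sinh (m * L) := mul_pos hm (Real.sinh_pos_iff.2 (mul_pos hm hL))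
  by_contra! hcon
  have := mul_pos hCpos (mul_pos h3 hcon)
  linarith

end Comparison

section Existence

/-- Solvability of `-D²v + m² v = q`, `v(0) = v(L) = 0`. -/
lemma exists_secondOrder {L m : ℝ} (hL : 0 < L) (hm : 0 < m) {q : ℝ → ℝ} (hq : Continuous q) :
    ∃ v v' : ℝ → ℝ, (∀ x, HasDerivAt v (v' x) x) ∧
      (∀ x, HasDerivAt v' (m ^ 2 * v x - q x) x) ∧ v 0 = 0 ∧ v L = 0 := by
  let P : ℝ → ℝ := fun x => ∫ s in (0:ℝ)..x, cosh (m * s) * q s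
  let Q : ℝ → ℝ := fun x => ∫ s in (0:ℝ)..x, sinh (m * s) * q s
  have hP : ∀ x, HasDerivAt P (cosh (m * x) * q x) x := fun x =>
    (Continuous.integral_hasStrictDerivAt (by fun_prop) 0 x).hasDerivAt
  have hQ : ∀ x, HasDerivAt Q (sinh (m * x) * q x) x := fun x =>
    (Continuous.integral_hasStrictDerivAt (by fun_prop) 0 x).hasDerivAt
  have hS0 : sinh (m * L) ≠ 0 := (Real.sinh_pos_iff.2 (mul_pos hm hL)).ne'
  have hP0 : P 0 = 0 := by simp [P]
  have hQ0 : Q 0 = 0 := by simp [Q]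
  let C : ℝ := (sinh (m * L) * P L - cosh (m * L) * Q L) / (m * sinh (m * L))
  refine ⟨fun x => C * sinh (m * x) - (sinh (m * x) * P x - cosh (m * x) * Q x) / m,
    fun x => C * (m * cosh (m * x)) - (cosh (m * x) * P x - sinh (m * x) * Q x),
    fun x => ?_, fun x => ?_, ?_, ?_⟩
  · exact (((hasDerivAt_sinh_mul m x).const_mul C).sub
      ((((hasDerivAt_sinh_mul m x).mul (hP x)).sub
        ((hasDerivAt_cosh_mul m x).mul (hQ x))).div_const m)).congr_deriv (by field_simp; ring)
  · have h := Real.cosh_sq (m * x)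
    refine ((((hasDerivAt_cosh_mul m x).const_mul m).const_mul C).sub
      (((hasDerivAt_cosh_mul m x).mul (hP x)).sub
        ((hasDerivAt_sinh_mul m x).mul (hQ x)))).congr_deriv ?_
    field_simp
    linear_combination (-q x) * h
  · simp [hP0, hQ0]
  · simp only [C]
    field_simp
    ring

/-- Solvability of `D²u = -v`, `u(0) = u(L) = 0`. -/
lemma exists_doublePrimitive {L : ℝ} (hL : 0 < L) {v : ℝ → ℝ} (hv : Continuous v) :
    ∃ u u' : ℝ → ℝ, (∀ x, HasDerivAt u (u' x) x) ∧
      (∀ x, HasDerivAt u' (-v x) x) ∧ u 0 = 0 ∧ u L = 0 := by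
  let V : ℝ → ℝ := fun x => ∫ s in (0:ℝ)..x, v s
  have hV : ∀ x, HasDerivAt V (v x) x := fun x => (hv.integral_hasStrictDerivAt 0 x).hasDerivAt
  have hVc : Continuous V := continuous_iff_continuousAt.2 fun x => (hV x).continuousAt
  let W : ℝ → ℝ := fun x => ∫ s in (0:ℝ)..x, V s
  have hW : ∀ x, HasDerivAt W (V x) x := fun x => (hVc.integral_hasStrictDerivAt 0 x).hasDerivAt
  refine ⟨fun x => W L / L * x - W x, fun x => W L / L - V x, fun x => ?_, fun x => ?_, ?_, ?_⟩
  · exact (((hasDerivAt_id x).const_mul (W L / L)).sub (hW x)).congr_deriv (by simp)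
  · exact (hV x).const_sub (W L / L)
  · simp [W]
  · simp only []
    field_simp
    ring

/-- Solvability of `D⁴u - m² D²u = q` with Navier boundary conditions. -/
lemma exists_navier {L m : ℝ} (hL : 0 < L) (hm : 0 < m) {q : ℝ → ℝ} (hq : Continuous q) :
    ∃ u : ℝ → ℝ, ContDiff ℝ 4 u ∧ IsNavierJet L (fun k => iteratedDeriv k u) ∧
      ∀ x, iteratedDeriv 4 u x - m ^ 2 * iteratedDeriv 2 u x = q x := by
  obtain ⟨v, v', hv, hv', v0, vL⟩ := exists_secondOrder hL hm hq
  have hvc : Continuous v := continuous_iff_continuousAt.2 fun x => (hv x).continuousAt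
  obtain ⟨u, u', hu, hu', u0, uL⟩ := exists_doublePrimitive hL hvc
  have d0 : iteratedDeriv 0 u = u := iteratedDeriv_zero
  have d1 : iteratedDeriv 1 u = u' := by
    rw [iteratedDeriv_succ, d0]; exact funext fun x => (hu x).deriv
  have d2 : iteratedDeriv 2 u = fun x => -v x := by
    rw [iteratedDeriv_succ, d1]; exact funext fun x => (hu' x).deriv
  have d3 : iteratedDeriv 3 u = fun x => -v' x := by
    rw [iteratedDeriv_succ, d2]; exact funext fun x => (hv x).neg.deriv
  have d4 : iteratedDeriv 4 u = fun x => -(m ^ 2 * v x - q x) := by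
    rw [iteratedDeriv_succ, d3]; exact funext fun x => (hv' x).neg.deriv
  have hd : ∀ k < 4, ∀ x, HasDerivAt (iteratedDeriv k u) (iteratedDeriv (k + 1) u x) x := by
    intro k hk x
    interval_cases k
    · rw [d0, d1]; exact hu x
    · rw [d1, d2]; exact hu' x
    · rw [d2, d3]; exact (hv x).neg
    · rw [d3, d4]; exact (hv' x).neg
  have hc : ∀ k ≤ 4, Continuous (iteratedDeriv k u) := fun k hk => by
    rcases hk.lt_or_eq with hk | rfl
    · exact continuous_iff_continuousAt.2 fun x => (hd k hk x).continuousAt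
    · rw [d4]; fun_prop
  refine ⟨u, ?_, ⟨fun k hk => (hc k hk).continuousOn, fun k hk x _ => hd k hk x,
    by simpa using u0, by simpa using uL, by simp [d2, v0], by simp [d2, vL]⟩, fun x => ?_⟩
  · refine contDiff_iff_iteratedDeriv (n := 4) |>.2 ⟨fun k hk => hc k (by exact_mod_cast hk),
      fun k hk x => (hd k (by exact_mod_cast hk) x).differentiableAt⟩
  · simp only [d4, d2]; ring

end Existence

section Melan

lemma IsNavierJet.mono_of_integral_le {L a b c : ℝ} (hL : 0 < L) (ha : 0 < a) (hb : 0 < b)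
    (hc : 0 < c) {p : ℝ → ℝ} {d e : ℕ → ℝ → ℝ} (hd : IsNavierJet L d) (he : IsNavierJet L e)
    (hde : ∀ x ∈ Set.Ioo 0 L, d 4 x - (a + b * ∫ t in (0:ℝ)..L, d 0 t) * d 2 x
      + c * ∫ t in (0:ℝ)..L, d 0 t = p x)
    (hee : ∀ x ∈ Set.Ioo 0 L, e 4 x - (a + b * ∫ t in (0:ℝ)..L, e 0 t) * e 2 x
      + c * ∫ t in (0:ℝ)..L, e 0 t = p x)
    (hd2 : ∀ x ∈ Set.Icc 0 L, d 2 x ≤ 0)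
    (he0 : 0 ≤ ∫ t in (0:ℝ)..L, e 0 t)
    (hI : ∫ t in (0:ℝ)..L, d 0 t ≤ ∫ t in (0:ℝ)..L, e 0 t) :
    ∀ x ∈ Set.Icc 0 L, e 0 x ≤ d 0 x ∧ d 2 x ≤ e 2 x := by
  set I := ∫ t in (0:ℝ)..L, d 0 t
  set J := ∫ t in (0:ℝ)..L, e 0 t
  have hA : 0 < a + b * J := by positivity
  have hj := hd.sub he
  have h2 := hj.second_nonpos hL (Real.sqrt_pos.2 hA) fun x hx => by
    rw [Real.sq_sqrt hA.le]
    have h1 := hde x hx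
    have h2 := hee x hx
    have h3 : 0 ≤ (J - I) * (c - b * d 2 x) := mul_nonneg (sub_nonneg.2 hI) (by
      have := mul_nonneg hb.le (neg_nonneg.2 (hd2 x (Set.Ioo_subset_Icc_self hx)))
      linarith)
    linear_combination h3 - h1 + h2
  exact fun x hx => ⟨sub_nonneg.1 (hj.nonneg hL h2 hx), sub_nonpos.1 (h2 x hx)⟩

lemma IsNavierJet.integral_mono {L : ℝ} (hL : 0 < L) {d e : ℕ → ℝ → ℝ} (hd : IsNavierJet L d)
    (he : IsNavierJet L e) (h : ∀ x ∈ Set.Icc 0 L, d 0 x ≤ e 0 x) :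
    ∫ t in (0:ℝ)..L, d 0 t ≤ ∫ t in (0:ℝ)..L, e 0 t :=
  intervalIntegral.integral_mono_on hL.le
    ((hd.cont 0 (by norm_num)).intervalIntegrable_of_Icc hL.le)
    ((he.cont 0 (by norm_num)).intervalIntegrable_of_Icc hL.le) h

/-- The threshold for stiffness `M` is a threshold for every smaller stiffness. -/
lemma threshold_of_le {L M N A : ℝ} (hL : 0 < L) (hM : 0 < M) (hN0 : 0 < N)
    (hN : N ≤ 4 * M / L ^ 3 * sigmaFun (√M * L)) (hA : 0 < A) (hAM : A ≤ M) :
    N * sigmaDen (√A * L) ≤ 12 * √A ^ 5 := by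
  have hr : 0 < √M := Real.sqrt_pos.2 hM
  have hsq : √M ^ 2 = M := Real.sq_sqrt hM.le
  have h1 : 4 * M / L ^ 3 * sigmaFun (√M * L) = 12 * √M ^ 5 / sigmaDen (√M * L) := by
    rw [sigmaFun, ← sigmaDen, ← mul_div_assoc]
    congr 1
    rw [← hsq, Real.sqrt_sq hr.le]
    field_simp
    ring
  rw [h1] at hN
  have hD : 0 < sigmaDen (√M * L) := by
    by_contra! hcon
    have := div_nonpos_of_nonneg_of_nonpos (show 0 ≤ 12 * √M ^ 5 by positivity) hcon
    linarith
  rw [le_div_iff₀ hD] at hN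
  have h2 := sigmaDen_mul_le (r := √A / √M) (x := √M * L) (by positivity)
    (div_le_one_of_le₀ (Real.sqrt_le_sqrt hAM) hr.le) (by positivity)
  have h3 : √A / √M * (√M * L) = √A * L := by field_simp
  rw [h3] at h2
  calc N * sigmaDen (√A * L) ≤ N * ((√A / √M) ^ 5 * sigmaDen (√M * L)) := by gcongr
    _ = (√A / √M) ^ 5 * (N * sigmaDen (√M * L)) := by ring
    _ ≤ (√A / √M) ^ 5 * (12 * √M ^ 5) := by gcongr
    _ = 12 * √A ^ 5 := by field_simp

/-- Existence of a fixed point of the mean value map between an ordered pair of lower and upper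
solutions. -/
lemma exists_solution_mem_Icc {L a b c : ℝ} (hL : 0 < L) (ha : 0 < a) (hb : 0 < b)
    {p : ℝ → ℝ} (hp : Continuous p) {d e : ℕ → ℝ → ℝ}
    (hd : IsNavierJet L d) (he : IsNavierJet L e)
    (hde : ∀ x ∈ Set.Ioo 0 L, d 4 x - (a + b * ∫ t in (0:ℝ)..L, d 0 t) * d 2 x
      + c * ∫ t in (0:ℝ)..L, d 0 t ≤ p x)
    (hee : ∀ x ∈ Set.Ioo 0 L, p x ≤ e 4 x - (a + b * ∫ t in (0:ℝ)..L, e 0 t) * e 2 x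
      + c * ∫ t in (0:ℝ)..L, e 0 t)
    (hI0 : 0 ≤ ∫ t in (0:ℝ)..L, d 0 t)
    (hI : ∫ t in (0:ℝ)..L, d 0 t ≤ ∫ t in (0:ℝ)..L, e 0 t) :
    ∃ u : ℝ → ℝ, ContDiff ℝ 4 u ∧ IsNavierJet L (fun k => iteratedDeriv k u) ∧
      (∀ x, iteratedDeriv 4 u x - (a + b * ∫ t in (0:ℝ)..L, u t) * iteratedDeriv 2 u x
        + c * ∫ t in (0:ℝ)..L, u t = p x) ∧
      ∫ t in (0:ℝ)..L, u t ∈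
        Set.Icc (∫ t in (0:ℝ)..L, d 0 t) (∫ t in (0:ℝ)..L, e 0 t) := by
  set I := ∫ t in (0:ℝ)..L, d 0 t
  set J := ∫ t in (0:ℝ)..L, e 0 t
  let A : ℝ → ℝ := fun r => a + b * |r|
  have hA : ∀ r, 0 < A r := fun r => by positivity
  have hAm : ∀ r, √(A r) ^ 2 = A r := fun r => Real.sq_sqrt (hA r).le
  have hm : ∀ r, 0 < √(A r) := fun r => Real.sqrt_pos.2 (hA r)
  have hAc : Continuous A := by fun_prop
  choose u hu hj heq using fun r =>
    exists_navier hL (hm r) (q := fun x => p x - c * r) (by fun_prop)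
  let Φ : ℝ → ℝ := fun r => ∫ t in (0:ℝ)..L, u r t
  have hΦ : ∀ r, Φ r = ∫ t in (0:ℝ)..L, unitLoadJet L (√(A r)) 0 t * (p t - c * r) := by
    intro r
    have h := (hj r).integral_eq hL (hm r)
    simp only [heq] at h
    simpa using h
  have hΦc : Continuous Φ := by
    rw [funext hΦ]
    refine intervalIntegral.continuous_parametric_intervalIntegral_of_continuous' ?_ _ _
    have h1 : ∀ z : ℝ, cosh z + 1 ≠ 0 := fun z => by have := Real.cosh_pos z; positivity
    have h2 : ∀ r : ℝ × ℝ, √(A r.1) ^ 2 ≠ 0 := fun r => by have := hm r.1; positivity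
    simp only [Function.uncurry_def, unitLoadJet]
    fun_prop (disch := first | exact fun x => h1 _ | exact fun x => h2 _ | simp [h1, h2])
  have hlow : I ≤ Φ I := by
    have hs := (hj I).sub hd
    have h2 := hs.second_nonpos hL (hm I) fun x hx => by
      have h1 := heq I x
      have h2 := hde x hx
      rw [hAm] at h1 ⊢
      simp only [A, abs_of_nonneg hI0] at h1 ⊢
      linarith
    have := hd.integral_mono hL (hj I) fun x hx => sub_nonneg.1 (hs.nonneg hL h2 hx)
    simpa [Φ] using this
  have hhigh : Φ J ≤ J := by
    have hs := he.sub (hj J)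
    have h2 := hs.second_nonpos hL (hm J) fun x hx => by
      have h1 := heq J x
      have h2 := hee x hx
      rw [hAm] at h1 ⊢
      simp only [A, abs_of_nonneg (hI0.trans hI)] at h1 ⊢
      linarith
    have := (hj J).integral_mono hL he fun x hx => sub_nonneg.1 (hs.nonneg hL h2 hx)
    simpa [Φ] using this
  obtain ⟨r, hr, hr0⟩ := intermediate_value_Icc hI
    (f := fun r => r - Φ r) (by fun_prop) (show (0:ℝ) ∈ _ from ⟨by linarith, by linarith⟩)
  have hr1 : ∫ t in (0:ℝ)..L, u r t = r := (sub_eq_zero.1 hr0).symm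
  refine ⟨u r, hu r, hj r, fun x => ?_, by rwa [hr1]⟩
  have h := heq r x
  rw [hAm] at h
  simp only [A, abs_of_nonneg (hI0.trans hr.1)] at h
  rw [hr1]
  linarith

end Melan

theorem stmt14 (L a b c : ℝ) (hL : 0 < L) (ha : 0 < a) (hb : 0 < b) (hc : 0 < c)
    (p : ℝ → ℝ) (hp : ContinuousOn p (Set.Icc 0 L))
    (M N : ℝ) (hM : 0 < M) (hN0 : 0 < N)
    (hN : N ≤ 4 * M / L ^ 3 * sigmaFun (Real.sqrt M * L))
    (α β : ℝ → ℝ)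
    (hα : IsMelanLowerSolution L a b c p α)
    (hβ : IsMelanUpperSolution L a b c p β)
    (hord : ∀ x ∈ Set.Icc (0:ℝ) L, 0 ≤ α x ∧ α x ≤ β x)
    (hord'' : ∀ x ∈ Set.Icc (0:ℝ) L,
      iteratedDerivWithin 2 α (Set.Icc 0 L) x ≤ 0 ∧
      iteratedDerivWithin 2 β (Set.Icc 0 L) x ≤ iteratedDerivWithin 2 α (Set.Icc 0 L) x)
    (hM' : a + b * ∫ t in (0:ℝ)..L, β t ≤ M)
    (hN' : c - b * sInf ((fun x => iteratedDerivWithin 2 β (Set.Icc 0 L) x) '' Set.Icc 0 L)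
      ≤ N) :
    ∃ ylo yhi : ℝ → ℝ,
      IsMelanSolution L a b c p ylo ∧ IsMelanSolution L a b c p yhi ∧
      (∀ x ∈ Set.Icc (0:ℝ) L,
        α x ≤ ylo x ∧ ylo x ≤ yhi x ∧ yhi x ≤ β x) ∧
      (∀ x ∈ Set.Icc (0:ℝ) L,
        iteratedDerivWithin 2 ylo (Set.Icc 0 L) x ≤ iteratedDerivWithin 2 α (Set.Icc 0 L) x ∧
        iteratedDerivWithin 2 yhi (Set.Icc 0 L) x ≤ iteratedDerivWithin 2 ylo (Set.Icc 0 L) x ∧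
        iteratedDerivWithin 2 β (Set.Icc 0 L) x ≤ iteratedDerivWithin 2 yhi (Set.Icc 0 L) x) ∧
      (∀ w : ℝ → ℝ, IsMelanSolution L a b c p w →
        (∀ x ∈ Set.Icc (0:ℝ) L, α x ≤ w x ∧ w x ≤ β x) →
        (∀ x ∈ Set.Icc (0:ℝ) L,
          iteratedDerivWithin 2 w (Set.Icc 0 L) x ≤ iteratedDerivWithin 2 α (Set.Icc 0 L) x ∧
          iteratedDerivWithin 2 β (Set.Icc 0 L) x ≤ iteratedDerivWithin 2 w (Set.Icc 0 L) x) →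
        ∀ x ∈ Set.Icc (0:ℝ) L,
          (ylo x ≤ w x ∧ w x ≤ yhi x) ∧
          iteratedDerivWithin 2 w (Set.Icc 0 L) x ≤ iteratedDerivWithin 2 ylo (Set.Icc 0 L) x ∧
          iteratedDerivWithin 2 yhi (Set.Icc 0 L) x ≤ iteratedDerivWithin 2 w (Set.Icc 0 L) x) := by
  obtain ⟨cα, eα, α0, αL, α20, αL2⟩ := hα
  obtain ⟨cβ, eβ, β0, βL, β20, βL2⟩ := hβ
  have jα := cα.isNavierJet hL α0 αL α20 αL2
  have jβ := cβ.isNavierJet hL β0 βL β20 βL2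
  have hIα : 0 ≤ ∫ t in (0:ℝ)..L, α t :=
    intervalIntegral.integral_nonneg hL.le fun t ht => (hord t ht).1
  have hIαβ : ∫ t in (0:ℝ)..L, α t ≤ ∫ t in (0:ℝ)..L, β t := by
    simpa using jα.integral_mono hL jβ (by simpa using fun x h0 h1 => (hord x ⟨h0, h1⟩).2)
  have hβN : ∀ x ∈ Set.Icc 0 L, 0 ≤ N - c + b * iteratedDerivWithin 2 β (Set.Icc 0 L) x := by
    intro x hx
    have h := csInf_le (isCompact_Icc.image_of_continuousOn (jβ.cont 2 (by norm_num))).bddBelow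
      (Set.mem_image_of_mem _ hx)
    have := mul_le_mul_of_nonneg_left h hb.le
    linarith
  obtain ⟨u, hu, ju, eu, hmem⟩ := exists_solution_mem_Icc (c := c) hL ha hb
    (p := Set.IccExtend hL.le ((Set.Icc 0 L).domRestrict p)) (continuousOn_iff_continuous_domRestrict.1 hp).Icc_extend' jα jβ
    (by
      intro x hx
      rw [Set.IccExtend_of_mem _ _ (Set.Ioo_subset_Icc_self hx)]
      simpa using eα x hx)
    (by
      intro x hx
      rw [Set.IccExtend_of_mem _ _ (Set.Ioo_subset_Icc_self hx)]
      simpa using eβ x hx)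
    (by simpa using hIα) (by simpa using hIαβ)
  simp only [iteratedDerivWithin_zero] at hmem
  have hwithin : ∀ k ≤ 4, ∀ x ∈ Set.Icc 0 L,
      iteratedDerivWithin k u (Set.Icc 0 L) x = iteratedDeriv k u x := fun k hk x hx =>
    iteratedDerivWithin_eq_iteratedDeriv (uniqueDiffOn_Icc hL)
      (hu.of_le (by exact_mod_cast hk)).contDiffAt hx
  have eu' : ∀ x ∈ Set.Ioo 0 L, iteratedDeriv 4 u x -
      (a + b * ∫ t in (0:ℝ)..L, u t) * iteratedDeriv 2 u x + c * ∫ t in (0:ℝ)..L, u t = p x := by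
    intro x hx
    rw [eu, Set.IccExtend_of_mem _ _ (Set.Ioo_subset_Icc_self hx)]
    rfl
  set I := ∫ t in (0:ℝ)..L, u t with hI
  have hA : 0 < a + b * I := by have := hIα.trans hmem.1; positivity
  have hAM : a + b * I ≤ M := by
    have := mul_le_mul_of_nonneg_left hmem.2 hb.le
    linarith
  have hthr := threshold_of_le hL hM hN0 hN hA hAM
  have hii : ∀ {d : ℕ → ℝ → ℝ}, IsNavierJet L d →
      IntervalIntegrable (d 0) MeasureTheory.volume 0 L := fun hd =>
    (hd.cont 0 (by norm_num)).intervalIntegrable_of_Icc hL.le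
  have jlo := ju.sub jα
  have jhi := jβ.sub ju
  have lo2 := jlo.second_nonpos_of_nonlocal hL (Real.sqrt_pos.2 hA) hN0.le hthr fun x hx => by
    have hxc := Set.Ioo_subset_Icc_self hx
    rw [intervalIntegral.integral_sub (hii ju) (hii jα), Real.sq_sqrt hA.le]
    simp only [iteratedDerivWithin_zero, iteratedDeriv_zero, ← hI]
    have h1 := eα x hx
    have h2 := eu' x hx
    have h3 := mul_nonneg (sub_nonneg.2 hmem.1)
      ((hβN x hxc).trans (by gcongr; exact (hord'' x hxc).2) :
        0 ≤ N - c + b * iteratedDerivWithin 2 α (Set.Icc 0 L) x)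
    linear_combination h3 + h1 - h2
  have hi2 := jhi.second_nonpos_of_nonlocal hL (Real.sqrt_pos.2 hA) hN0.le hthr fun x hx => by
    have hxc := Set.Ioo_subset_Icc_self hx
    rw [intervalIntegral.integral_sub (hii jβ) (hii ju), Real.sq_sqrt hA.le]
    simp only [iteratedDerivWithin_zero, iteratedDeriv_zero, ← hI]
    have h1 := eβ x hx
    have h2 := eu' x hx
    have h3 := mul_nonneg (sub_nonneg.2 hmem.2) (hβN x hxc)
    linear_combination h3 + h1 + h2
  have lo0 : ∀ x ∈ Set.Icc 0 L, α x ≤ u x := fun x hx => by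
    simpa using jlo.nonneg hL lo2 hx
  have hi0 : ∀ x ∈ Set.Icc 0 L, u x ≤ β x := fun x hx => by
    simpa using jhi.nonneg hL hi2 hx
  have hsol : IsMelanSolution L a b c p u := by
    refine ⟨hu.contDiffOn, fun x hx => ?_, by simpa using ju.left, by simpa using ju.right, ?_, ?_⟩
    · have hxc := Set.Ioo_subset_Icc_self hx
      rw [hwithin 4 le_rfl x hxc, hwithin 2 (by norm_num) x hxc]
      exact eu' x hx
    · rw [hwithin 2 (by norm_num) 0 (Set.left_mem_Icc.2 hL.le)]; exact ju.left2
    · rw [hwithin 2 (by norm_num) L (Set.right_mem_Icc.2 hL.le)]; exact ju.right2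
  have u2 : ∀ x ∈ Set.Icc 0 L, iteratedDeriv 2 u x ≤ 0 := fun x hx =>
    (sub_nonpos.1 (lo2 x hx)).trans (hord'' x hx).1
  refine ⟨u, u, hsol, hsol, fun x hx => ⟨lo0 x hx, le_rfl, hi0 x hx⟩, fun x hx => ?_, ?_⟩
  · rw [hwithin 2 (by norm_num) x hx]
    exact ⟨sub_nonpos.1 (lo2 x hx), le_rfl, sub_nonpos.1 (hi2 x hx)⟩
  intro w ⟨cw, ew, w0, wL, w20, wL2⟩ hw hw2
  have jw := cw.isNavierJet hL w0 wL w20 wL2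
  have hwI : 0 ≤ ∫ t in (0:ℝ)..L, w t :=
    intervalIntegral.integral_nonneg hL.le fun t ht => (hord t ht).1.trans (hw t ht).1
  have w2 : ∀ x ∈ Set.Icc 0 L, iteratedDerivWithin 2 w (Set.Icc 0 L) x ≤ 0 := fun x hx =>
    (hw2 x hx).1.trans (hord'' x hx).1
  have huw : I ≤ ∫ t in (0:ℝ)..L, w t → ∀ x ∈ Set.Icc 0 L,
      w x ≤ u x ∧ iteratedDeriv 2 u x ≤ iteratedDerivWithin 2 w (Set.Icc 0 L) x := fun h => by
    simpa using ju.mono_of_integral_le hL ha hb hc jw (p := p) (by simpa using eu')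
      (by simpa using ew) u2 (by simpa using hwI) (by simpa using h)
  have hwu : ∫ t in (0:ℝ)..L, w t ≤ I → ∀ x ∈ Set.Icc 0 L,
      u x ≤ w x ∧ iteratedDerivWithin 2 w (Set.Icc 0 L) x ≤ iteratedDeriv 2 u x := fun h => by
    simpa using jw.mono_of_integral_le hL ha hb hc ju (p := p) (by simpa using ew)
      (by simpa using eu') w2 (by simpa using hIα.trans hmem.1) (by simpa using h)
  have hIw : I = ∫ t in (0:ℝ)..L, w t := by
    rcases le_total I (∫ t in (0:ℝ)..L, w t) with h | h
    · refine le_antisymm h ?_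
      simpa using jw.integral_mono hL ju (by simpa using fun x h0 h1 => (huw h x ⟨h0, h1⟩).1)
    · refine le_antisymm ?_ h
      simpa using ju.integral_mono hL jw (by simpa using fun x h0 h1 => (hwu h x ⟨h0, h1⟩).1)
  intro x hx
  rw [hwithin 2 (by norm_num) x hx]
  have h1 := huw hIw.le x hx
  have h2 := hwu hIw.ge x hx
  exact ⟨⟨h2.1, h1.1⟩, h2.2, h1.2⟩
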